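/- Let N be an even positive integer, k an integer with 0 ≤ k ≤ N, and n̄ a nonnegative integer. Then the probability that a uniformly random grouping of [k,N] produces strictly fewer than n̄ ww-pairs is at most twice the corresponding probability for the iid set with per-ball white-probability k/N: ε(n̄ | [k,N]) ≤ 2 ε(n̄ | [p_u = k/N, N]_iid). (Paper's Result 2.1, abstract form.) -/

import Mathlib

/-- Number of ww-pairs: positions are grouped into the pairs `{2i, 2i+1}`; the ball at
position `j` is white iff `σ j < k`. A uniformly random permutation `σ` of the `N`
positions realizes a uniformly random grouping (perfect matching) of a set of
`k` white and `N - k` black balls. -/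
def wwCount (N k : ℕ) (σ : Equiv.Perm (Fin N)) : ℕ :=
  (Finset.univ.filter fun i : Fin (N / 2) =>
    (σ ⟨2 * i.1, by have := i.isLt; omega⟩).1 < k ∧
    (σ ⟨2 * i.1 + 1, by have := i.isLt; omega⟩).1 < k).card

/-- ε(n̄ | [k,N]): the probability that a uniformly random grouping of `[k,N]`
produces strictly fewer than `n̄` ww-pairs. -/
noncomputable def epsWW (N k nbar : ℕ) : ℝ :=
  (Finset.univ.filter fun σ : Equiv.Perm (Fin N) => wwCount N k σ < nbar).card /
    (Fintype.card (Equiv.Perm (Fin N)))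

/-- ε(n̄ | [p,N]_iid): the binomial mixture Σ_m C(N,m) p^m (1-p)^(N-m) ε(n̄ | [m,N]). -/
noncomputable def epsWWiid (N nbar : ℕ) (p : ℝ) : ℝ :=
  ∑ m ∈ Finset.range (N + 1),
    (N.choose m : ℝ) * p ^ m * (1 - p) ^ (N - m) * epsWW N m nbar

theorem wwCount_mono (N : ℕ) {m k : ℕ} (h : m ≤ k) (σ : Equiv.Perm (Fin N)) :
    wwCount N m σ ≤ wwCount N k σ := by
  unfold wwCount
  apply Finset.card_le_card
  intro i hi
  simp only [Finset.mem_filter, Finset.mem_univ, true_and] at hi ⊢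
  omega

theorem epsWW_anti (N nbar : ℕ) {m k : ℕ} (h : m ≤ k) :
    epsWW N k nbar ≤ epsWW N m nbar := by
  unfold epsWW
  gcongr with σ
  exact wwCount_mono N h σ

theorem epsWW_nonneg (N k nbar : ℕ) : 0 ≤ epsWW N k nbar := by
  unfold epsWW
  positivity

/-- Abstract single-crossing comparison. -/
theorem seq_compare (s t : ℕ) (hs : 0 < s) (ht : 0 < t) (a c : ℕ → ℝ)
    (ha0 : ∀ j, 0 ≤ a j) (hc0 : ∀ j, 0 ≤ c j)
    (ha : ∀ j, s < j → a j = 0) (hc : ∀ j, t ≤ j → c j = 0)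
    (hra : ∀ j, a (j + 1) * ((t + j + 1) * s) = a j * ((s - j) * t))
    (hrc : ∀ j, c (j + 1) * ((s + j + 2) * t) = c j * ((t - j - 1) * s))
    (h0 : ((s : ℝ) + 1) * c 0 = s * a 0) (n : ℕ) (hn : s + t < n) :
    ∑ j ∈ Finset.range n, c j ≤ ∑ j ∈ Finset.range n, a j := by
  have hs' : (1 : ℝ) ≤ s := by exact_mod_cast hs
  have ht' : (1 : ℝ) ≤ t := by exact_mod_cast ht
  have hstart : c 0 ≤ a 0 := by
    have := hc0 0
    have h1 : (s : ℝ) * c 0 ≤ s * a 0 := by linarith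
    exact le_of_mul_le_mul_left h1 (by linarith)
  -- mean identities
  have hA : ∀ n : ℕ, ∑ j ∈ Finset.range n, ((s : ℝ) + t) * (j * a j)
      = s * t * a 0 - s * (t + n) * a n := by
    intro n
    induction n with
    | zero => simp
    | succ n ih =>
      rw [Finset.sum_range_succ, ih]
      have := hra n
      push_cast
      linarith
  have hC : ∀ n : ℕ, ∑ j ∈ Finset.range n, ((s : ℝ) + t) * ((j + 1) * c j)
      = (s + 1) * t * c 0 - (s + 1 + n) * t * c n := by
    intro n
    induction n with
    | zero => simp
    | succ n ih =>
      rw [Finset.sum_range_succ, ih]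
      have := hrc n
      push_cast
      linarith
  have hmean : 0 ≤ ∑ j ∈ Finset.range n, (j : ℝ) * (a j - c j) := by
    have h1 := hA n
    have h2 := hC n
    rw [ha n (by omega)] at h1
    rw [hc n (by omega)] at h2
    rw [← Finset.mul_sum] at h1 h2
    have h3 : ((s : ℝ) + t) * (∑ j ∈ Finset.range n, (j : ℝ) * a j)
        = (s + t) * (∑ j ∈ Finset.range n, ((j : ℝ) + 1) * c j) := by
      rw [h1, h2]; linear_combination (-(t : ℝ)) * h0
    have h4 := mul_left_cancel₀ (by positivity) h3
    have h5 : ∑ j ∈ Finset.range n, (j : ℝ) * (a j - c j)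
        = ∑ j ∈ Finset.range n, c j := by
      have : ∀ j ∈ Finset.range n, (j : ℝ) * (a j - c j)
          = j * a j - (j + 1) * c j + c j := by intro j _; ring
      rw [Finset.sum_congr rfl this, Finset.sum_add_distrib, Finset.sum_sub_distrib, h4]
      ring
    rw [h5]
    exact Finset.sum_nonneg fun j _ => hc0 j
  -- step lemmas
  have up : ∀ j : ℕ, ((j : ℝ) + 1) ^ 2 * (t ^ 2 - s ^ 2) ≤ t ^ 2 * (2 * s + 1) →
      c j ≤ a j → c (j + 1) ≤ a (j + 1) := by
    intro j hQ hj
    by_cases hjt : t ≤ j + 1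
    · rw [hc _ hjt]; exact ha0 _
    have hjt' : (j : ℝ) + 1 + 1 ≤ t := by exact_mod_cast (by omega : j + 1 + 1 ≤ t)
    have hj0 : (0 : ℝ) ≤ j := Nat.cast_nonneg j
    have key : ((t : ℝ) - j - 1) * s * ((t + j + 1) * s)
        ≤ ((s - j) * t) * ((s + j + 2) * t) := by nlinarith
    have hp1 : (0 : ℝ) < (t + j + 1) * s := by positivity
    have hp2 : (0 : ℝ) < (s + j + 2) * t := by positivity
    have hnn : (0 : ℝ) ≤ ((t : ℝ) - j - 1) * s * ((t + j + 1) * s) :=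
      mul_nonneg (mul_nonneg (by linarith) (by linarith)) hp1.le
    refine le_of_mul_le_mul_right ?_ (mul_pos hp1 hp2)
    calc c (j + 1) * (((t : ℝ) + j + 1) * s * ((s + j + 2) * t))
        = c j * (((t : ℝ) - j - 1) * s * ((t + j + 1) * s)) := by
          linear_combination (((t : ℝ) + j + 1) * s) * hrc j
      _ ≤ a j * (((s - j) * t) * ((s + j + 2) * t)) :=
          mul_le_mul hj key hnn (ha0 j)
      _ = a (j + 1) * (((t : ℝ) + j + 1) * s * ((s + j + 2) * t)) := by
          linear_combination (-((s + j + 2) * t : ℝ)) * hra j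
  have down : ∀ j : ℕ, t ^ 2 * (2 * s + 1) < ((j : ℝ) + 1) ^ 2 * (t ^ 2 - s ^ 2) →
      a j ≤ c j → a (j + 1) ≤ c (j + 1) := by
    intro j hQ hj
    by_cases hjs : s ≤ j
    · rw [ha _ (by omega)]; exact hc0 _
    have hjs' : (j : ℝ) + 1 ≤ s := by exact_mod_cast (by omega : j + 1 ≤ s)
    have hj0 : (0 : ℝ) ≤ j := Nat.cast_nonneg j
    have key : ((s - j) * t) * ((s + j + 2) * t)
        ≤ ((t : ℝ) - j - 1) * s * ((t + j + 1) * s) := by nlinarith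
    have hp1 : (0 : ℝ) < (t + j + 1) * s := by positivity
    have hp2 : (0 : ℝ) < (s + j + 2) * t := by positivity
    have hnn : (0 : ℝ) ≤ ((s - j) * t) * ((s + j + 2) * t) :=
      mul_nonneg (mul_nonneg (by linarith) (by linarith)) hp2.le
    refine le_of_mul_le_mul_right ?_ (mul_pos hp1 hp2)
    calc a (j + 1) * (((t : ℝ) + j + 1) * s * ((s + j + 2) * t))
        = a j * (((s - j) * t) * ((s + j + 2) * t)) := by
          linear_combination ((s + j + 2) * t : ℝ) * hra j
      _ ≤ c j * (((t : ℝ) - j - 1) * s * ((t + j + 1) * s)) :=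
          mul_le_mul hj key hnn (hc0 j)
      _ = c (j + 1) * (((t : ℝ) + j + 1) * s * ((s + j + 2) * t)) := by
          linear_combination (-(((t : ℝ) + j + 1) * s)) * hrc j
  by_cases hall : ∀ j, c j ≤ a j
  · exact Finset.sum_le_sum fun j _ => hall j
  push Not at hall
  classical
  set J := Nat.find hall with hJ
  have hJspec : a J < c J := Nat.find_spec hall
  have hJmin : ∀ j, j < J → c j ≤ a j := fun j hj => not_lt.mp (Nat.find_min hall hj)
  have hJpos : 0 < J := by
    rcases Nat.eq_zero_or_pos J with h | h
    · rw [h] at hJspec; linarith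
    · exact h
  obtain ⟨i, hi⟩ : ∃ i, J = i + 1 := ⟨J - 1, by omega⟩
  have hQJ : t ^ 2 * (2 * s + 1) < ((i : ℝ) + 1) ^ 2 * (t ^ 2 - s ^ 2) := by
    by_contra hcon
    have := up i (not_lt.mp hcon) (hJmin i (by omega))
    rw [← hi] at this
    linarith
  have hpos : (0 : ℝ) < (t : ℝ) ^ 2 - s ^ 2 := by
    by_contra hcon
    have h1 : ((i : ℝ) + 1) ^ 2 * (t ^ 2 - s ^ 2) ≤ 0 :=
      mul_nonpos_of_nonneg_of_nonpos (by positivity) (not_lt.mp hcon)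
    have h2 : (0 : ℝ) ≤ t ^ 2 * (2 * s + 1) := by positivity
    linarith
  have hafter : ∀ j, J ≤ j → a j ≤ c j := by
    intro j hj
    induction j, hj using Nat.le_induction with
    | base => exact hJspec.le
    | succ j hj ih =>
      refine down j (lt_of_lt_of_le hQJ ?_) ih
      have : (i : ℝ) ≤ j := by exact_mod_cast (by omega : i ≤ j)
      gcongr
  have hfin : 0 ≤ (J : ℝ) * ∑ j ∈ Finset.range n, (a j - c j) := by
    refine hmean.trans ?_
    rw [Finset.mul_sum]
    refine Finset.sum_le_sum fun j _ => ?_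
    rcases lt_or_ge j J with h | h
    · have h1 : (j : ℝ) ≤ J := by exact_mod_cast h.le
      exact mul_le_mul_of_nonneg_right h1 (by linarith [hJmin j h])
    · have h1 : (J : ℝ) ≤ j := by exact_mod_cast h
      exact mul_le_mul_of_nonpos_right h1 (by linarith [hafter j h])
  have hJp : (0 : ℝ) < J := by exact_mod_cast hJpos
  have := nonneg_of_mul_nonneg_right hfin hJp
  rw [Finset.sum_sub_distrib] at this
  linarith

theorem binom_rec (s t m : ℕ) :
    (((s + t).choose (m + 1) : ℝ) * s ^ (m + 1) * t ^ (s + t - (m + 1))) * ((m + 1) * t)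
      = (((s + t).choose m : ℝ) * s ^ m * t ^ (s + t - m)) * ((s + t - m) * s) := by
  rcases lt_trichotomy m (s + t) with h | h | h
  · obtain ⟨r, hr⟩ : ∃ r, s + t = m + 1 + r := ⟨s + t - (m + 1), by omega⟩
    have e1 : s + t - (m + 1) = r := by omega
    have e2 : s + t - m = r + 1 := by omega
    have h1 := Nat.choose_succ_right_eq (s + t) m
    have h2 : ((s + t).choose (m + 1) : ℝ) * (m + 1) = (s + t).choose m * (r + 1) := by
      rw [e2] at h1; exact_mod_cast h1
    have h3 : (s : ℝ) + t - m = r + 1 := by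
      have : (s : ℝ) + t = m + 1 + r := by exact_mod_cast hr
      linarith
    rw [e1, e2, h3, pow_succ, pow_succ]
    linear_combination ((s : ℝ) ^ m * s * t ^ r * t) * h2
  · subst h
    rw [Nat.choose_succ_self]
    push_cast
    ring
  · rw [Nat.choose_eq_zero_of_lt h, Nat.choose_eq_zero_of_lt (by omega : s + t < m + 1)]
    simp

theorem half_binom (s t : ℕ) (hs : 0 < s) (ht : 0 < t) :
    ((s : ℝ) + t) ^ (s + t) ≤ 2 * ∑ m ∈ Finset.range (s + 1),
      ((s : ℝ) ^ m * t ^ (s + t - m) * (s + t).choose m) := by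
  set b : ℕ → ℝ := fun m => ((s + t).choose m : ℝ) * s ^ m * t ^ (s + t - m) with hb
  have hb0 : ∀ m, 0 ≤ b m := fun m => by simp only [hb]; positivity
  have hrec : ∀ m : ℕ, b (m + 1) * (((m : ℝ) + 1) * t) = b m * ((s + t - m) * s) :=
    fun m => binom_rec s t m
  have hbz : ∀ m, s + t < m → b m = 0 := fun m hm => by
    simp only [hb]; rw [Nat.choose_eq_zero_of_lt hm]; simp
  have hmain := seq_compare s t hs ht (fun j => if j ≤ s then b (s - j) else 0)
    (fun j => b (s + 1 + j))
    (fun j => by split_ifs; exacts [hb0 _, le_rfl]) (fun j => hb0 _)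
    (fun j hj => by simp [not_le.mpr hj]) (fun j hj => hbz _ (by omega))
    (fun j => by
      rcases lt_trichotomy j s with h | h | h
      · obtain ⟨r, hr⟩ : ∃ r, s = j + 1 + r := ⟨s - (j + 1), by omega⟩
        have e1 : s - (j + 1) = r := by omega
        have e2 : s - j = r + 1 := by omega
        rw [if_pos (by omega), if_pos (by omega), e1, e2]
        have := hrec r
        have h3 : (s : ℝ) = j + 1 + r := by exact_mod_cast hr
        have h4 : (r : ℝ) = s - j - 1 := by linarith
        rw [h4] at this
        linear_combination -this
      · subst h
        simp
      · rw [if_neg (by omega), if_neg (by omega)]; simp)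
    (fun j => by
      have := hrec (s + 1 + j)
      push_cast at this
      rw [← add_assoc]
      linear_combination this)
    (by
      have := hrec s
      have ht' : (t : ℝ) ≠ 0 := by positivity
      simp only [Nat.zero_le, if_true, Nat.sub_zero, Nat.add_zero]
      apply mul_right_cancel₀ ht'
      linear_combination this)
    (s + 1 + t) (by omega)
  have hA : ∑ j ∈ Finset.range (s + 1 + t), (if j ≤ s then b (s - j) else 0)
      = ∑ m ∈ Finset.range (s + 1), b m := by
    rw [Finset.sum_range_add, ← Finset.sum_range_reflect b (s + 1)]
    rw [Finset.sum_eq_zero (s := Finset.range t), add_zero]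
    · refine Finset.sum_congr rfl fun j hj => ?_
      rw [Finset.mem_range] at hj
      rw [if_pos (by omega)]
      congr 1
    · intro j _
      rw [if_neg (by omega)]
  have hC : ∑ j ∈ Finset.range t, b (s + 1 + j)
      ≤ ∑ j ∈ Finset.range (s + 1 + t), b (s + 1 + j) :=
    Finset.sum_le_sum_of_subset_of_nonneg (Finset.range_subset_range.mpr (by omega))
      (fun _ _ _ => hb0 _)
  have htot : ((s : ℝ) + t) ^ (s + t) = ∑ m ∈ Finset.range (s + 1 + t), b m := by
    rw [add_pow, show s + t + 1 = s + 1 + t by omega]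
    refine Finset.sum_congr rfl fun m _ => ?_
    simp only [hb]; ring
  rw [Finset.sum_range_add] at htot
  have hfin : ∑ m ∈ Finset.range (s + 1), ((s : ℝ) ^ m * t ^ (s + t - m) * (s + t).choose m)
      = ∑ m ∈ Finset.range (s + 1), b m :=
    Finset.sum_congr rfl fun m _ => by simp only [hb]; ring
  rw [hfin, htot]
  rw [hA] at hmain
  linarith

theorem half_prob (N k : ℕ) (hNpos : 0 < N) (hk : k ≤ N) :
    1 ≤ 2 * ∑ m ∈ Finset.range (k + 1),
      (N.choose m : ℝ) * ((k : ℝ) / N) ^ m * (1 - (k : ℝ) / N) ^ (N - m) := by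
  have hN : (0 : ℝ) < N := by exact_mod_cast hNpos
  rcases Nat.eq_zero_or_pos k with h | h
  · subst h; simp
  rcases hk.eq_or_lt with h' | h'
  · subst h'
    have := add_pow ((k : ℝ) / k) (1 - (k : ℝ) / k) k
    rw [add_sub_cancel, one_pow] at this
    have e : ∑ m ∈ Finset.range (k + 1),
        (k.choose m : ℝ) * ((k : ℝ) / k) ^ m * (1 - (k : ℝ) / k) ^ (k - m) = 1 := by
      refine Eq.trans (Finset.sum_congr rfl fun m _ => ?_) this.symm
      ring
    rw [e]; norm_num
  obtain ⟨t, rfl⟩ : ∃ t, N = k + t := ⟨N - k, by omega⟩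
  have hb := half_binom k t h (by omega)
  push_cast at hN ⊢
  have e : ∀ m ∈ Finset.range (k + 1),
      ((k + t).choose m : ℝ) * ((k : ℝ) / (k + t)) ^ m * (1 - (k : ℝ) / (k + t)) ^ (k + t - m)
      = ((k : ℝ) ^ m * t ^ (k + t - m) * (k + t).choose m) / ((k : ℝ) + t) ^ (k + t) := by
    intro m hm
    rw [Finset.mem_range] at hm
    have h1 : 1 - (k : ℝ) / (k + t) = t / (k + t) := by field_simp; ring
    have h2 : ((k : ℝ) + t) ^ (k + t) = (k + t) ^ m * (k + t) ^ (k + t - m) := by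
      rw [← pow_add]; congr 1; omega
    rw [h1, h2, div_pow, div_pow]
    field_simp
  rw [Finset.sum_congr rfl e, ← Finset.sum_div, ← mul_div_assoc, le_div_iff₀ (by positivity)]
  linarith

/-- Paper's Result 2.1 (abstract form): ε(n̄ | [k,N]) ≤ 2 ε(n̄ | [p_u = k/N, N]_iid). -/
theorem result21_abstract (N k nbar : ℕ) (hN : Even N) (hNpos : 0 < N) (hk : k ≤ N) :
    epsWW N k nbar ≤ 2 * epsWWiid N nbar ((k : ℝ) / N) := by
  have hN' : (0 : ℝ) < N := by exact_mod_cast hNpos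
  have hp0 : 0 ≤ (k : ℝ) / N := by positivity
  have hp1 : 0 ≤ 1 - (k : ℝ) / N := by
    rw [sub_nonneg, div_le_one hN']; exact_mod_cast hk
  have h1 : ∑ m ∈ Finset.range (k + 1), (N.choose m : ℝ) * ((k : ℝ) / N) ^ m *
      (1 - (k : ℝ) / N) ^ (N - m) * epsWW N k nbar ≤ epsWWiid N nbar ((k : ℝ) / N) := by
    unfold epsWWiid
    refine le_trans (Finset.sum_le_sum fun m hm => ?_)
      (Finset.sum_le_sum_of_subset_of_nonneg
        (Finset.range_subset_range.mpr (by omega : k + 1 ≤ N + 1)) fun m _ _ => ?_)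
    · rw [Finset.mem_range] at hm
      exact mul_le_mul_of_nonneg_left (epsWW_anti N nbar (by omega)) (by positivity)
    · have := epsWW_nonneg N m nbar
      positivity
  rw [← Finset.sum_mul] at h1
  have h2 := mul_le_mul_of_nonneg_right (half_prob N k hNpos hk) (epsWW_nonneg N k nbar)
  linarith
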